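/- arXiv:2101.06743 — 6 statements merged into one kernel-verified Lean document; each statement's English description precedes it below -/
import Mathlib

section
/- Let k ≥ 2, let q be a prime power divisible by 3, and let a_1 ∈ F_q with a_1 ≠ 0. In the 3-partite 3-uniform hypergraph D_3(k,q), the link of the vertex (a_1, 0, …, 0) in part A is isomorphic to the link of the vertex (1, 0, …, 0) in part A. -/
open scoped Classical

namespace Paper

/-- `G` contains a copy of `F` (an injective graph homomorphism of `F` into `G`). -/
def HasGraphCopy {α β : Type*} (F : SimpleGraph α) (G : SimpleGraph β) : Prop :=
  ∃ f : α ↪ β, ∀ u v, F.Adj u v → G.Adj (f u) (f v)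

/-- The 3-uniform hypergraph `H` contains a copy of the 3-uniform hypergraph `F`. -/
def HasHypCopy {α β : Type*} (F : Set (Finset α)) (H : Set (Finset β)) : Prop :=
  ∃ f : α ↪ β, ∀ e ∈ F, e.map f ∈ H

/-- The suspension `Ĝ` of a graph `G`: a new vertex (`none`) joined to all vertices of `G`. -/
def suspension {α : Type*} (G : SimpleGraph α) : SimpleGraph (Option α) :=
  SimpleGraph.fromRel (fun x y => x = none ∨ ∃ u v, x = some u ∧ y = some v ∧ G.Adj u v)

/-- The hypergraph suspension `G̃` of a graph `G`: the triples `{x, u, v}` over edges `uv` of `G`,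
where `x = none` is a new vertex. -/
def hypSuspension {α : Type*} (G : SimpleGraph α) : Set (Finset (Option α)) :=
  {e | ∃ u v, G.Adj u v ∧ e = {none, some u, some v}}

/-- `ex(n, K₃, F)`: the maximum number of triangles in an `F`-free graph on `n` vertices. -/
noncomputable def exTriangles {α : Type*} (n : ℕ) (F : SimpleGraph α) : ℕ :=
  sSup {t | ∃ G : SimpleGraph (Fin n),
    ¬ HasGraphCopy F G ∧ t = {s : Finset (Fin n) | G.IsNClique 3 s}.ncard}

/-- `ex₃(n, F)`: the maximum number of triples in an `F`-free 3-uniform hypergraph on `n`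
vertices. -/
noncomputable def ex3 {α : Type*} (n : ℕ) (F : Set (Finset α)) : ℕ :=
  sSup {t | ∃ H : Finset (Finset (Fin n)), (∀ e ∈ H, e.card = 3) ∧
    ¬ HasHypCopy F (↑H : Set (Finset (Fin n))) ∧ t = H.card}

/-- `ex(n, C_m)`: the maximum number of edges in a graph on `n` vertices with no cycle of
length `m`. -/
noncomputable def exCycle (n m : ℕ) : ℕ :=
  sSup {t | ∃ G : SimpleGraph (Fin n),
    ¬ HasGraphCopy (SimpleGraph.cycleGraph m) G ∧ t = G.edgeSet.ncard}

/-- The link of a vertex `x` in a 3-uniform hypergraph `H`: `u ~ v` iff `{x, u, v} ∈ H`. -/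
def linkGraph {V : Type*} (H : Set (Finset V)) (x : V) : SimpleGraph V :=
  SimpleGraph.fromRel (fun u v => u ≠ x ∧ v ≠ x ∧ ({x, u, v} : Finset V) ∈ H)

/-!  Coordinates of a vector are labelled `x_1, x_{11}, x_{12}, x_{21}, x_{22}, x'_{22}, x_{23},
x_{32}, x_{33}, x'_{33}, x_{34}, x_{43}, …` and indexed `0, 1, 2, …`.  The `j`-th defining
equation (`j ≥ 1`) of the graph `D(q)` has the form `a_j + b_j + a_{aIdx j} * b_{bIdx j} = 0`. -/

/-- Index of the `a`-coordinate in the product term of the `j`-th equation. -/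
def aIdx : ℕ → ℕ
  | 1 => 0
  | 2 => 0
  | 3 => 1
  | j => if j % 4 = 0 ∨ j % 4 = 3 then j - 2 else 0

/-- Index of the `b`-coordinate in the product term of the `j`-th equation. -/
def bIdx : ℕ → ℕ
  | 1 => 0
  | 2 => 1
  | 3 => 0
  | j => if j % 4 = 0 ∨ j % 4 = 3 then 0 else j - 2

/-- Index of the extra linear term in the `j`-th equation of `D'(q)` (for `j ≥ 2`). -/
def linIdx : ℕ → ℕ
  | 2 => 1
  | j => j - 2

/-- Extend a vector in `F^k` to an `ℕ`-indexed sequence by zeros. -/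
def ext {k : ℕ} {F : Type*} [Zero F] (a : Fin k → F) (j : ℕ) : F :=
  if h : j < k then a ⟨j, h⟩ else 0

/-- The defining relation of the 3-graph `D₃(k,q)`: the first `k-1` equations. -/
def D3rel (k : ℕ) (F : Type*) [CommRing F] (a b c : Fin k → F) : Prop :=
  ∀ j : ℕ, 1 ≤ j → j < k →
    ext a j + ext b j + ext c j
      + ext a (aIdx j) * ext b (bIdx j)
      + ext b (aIdx j) * ext c (bIdx j)
      + ext c (aIdx j) * ext a (bIdx j) = 0

/-- The defining relation of the bipartite graph `D(k,q)`: the first `k-1` equations. -/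
def Drel (k : ℕ) (F : Type*) [CommRing F] (a b : Fin k → F) : Prop :=
  ∀ j : ℕ, 1 ≤ j → j < k →
    ext a j + ext b j + ext a (aIdx j) * ext b (bIdx j) = 0

/-- The defining relation of the bipartite graph `D'(k,q)`: the first `k-1` equations. -/
def D'rel (k : ℕ) (F : Type*) [CommRing F] (a b : Fin k → F) : Prop :=
  ∀ j : ℕ, 1 ≤ j → j < k →
    if j = 1 then
      ext a 1 - ext a 0 + ext b 1 - ext b 0 + ext a 0 * ext b 0 = 0
    else
      ext a j + ext a (linIdx j) + ext b j + ext b (linIdx j)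
        + ext a (aIdx j) * ext b (bIdx j) = 0

/-- The bipartite graph `D(k,q)` on two copies of `F^k`. -/
def DGraph (k : ℕ) (F : Type*) [CommRing F] :
    SimpleGraph ((Fin k → F) ⊕ (Fin k → F)) :=
  SimpleGraph.fromRel (fun x y => ∃ a b, x = Sum.inl a ∧ y = Sum.inr b ∧ Drel k F a b)

/-- The bipartite graph `D'(k,q)` on two copies of `F^k`. -/
def D'Graph (k : ℕ) (F : Type*) [CommRing F] :
    SimpleGraph ((Fin k → F) ⊕ (Fin k → F)) :=
  SimpleGraph.fromRel (fun x y => ∃ a b, x = Sum.inl a ∧ y = Sum.inr b ∧ D'rel k F a b)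

/-- `{a,b,c}`-membership for the link of a vertex `v` lying in part `p` of `D₃(k,q)`:
for `p = 0` (part `A`) the two remaining parts are `B, C`; for `p = 1` (part `B`) they are
`C, A`; for `p = 2` (part `C`) they are `A, B`. -/
def D3edgeProp (k : ℕ) (F : Type*) [CommRing F] (p : Fin 3) (v u w : Fin k → F) : Prop :=
  if p = 0 then D3rel k F v u w
  else if p = 1 then D3rel k F w v u
  else D3rel k F u w v

/-- The link of the vertex `v` in part `p` of the 3-partite 3-graph `D₃(k,q)`, as a bipartite
graph on the two remaining parts. -/
def linkD3 (k : ℕ) (F : Type*) [CommRing F] (p : Fin 3) (v : Fin k → F) :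
    SimpleGraph ((Fin k → F) ⊕ (Fin k → F)) :=
  SimpleGraph.fromRel
    (fun x y => ∃ u w, x = Sum.inl u ∧ y = Sum.inr w ∧ D3edgeProp k F p v u w)


/-- The weight of the `j`-th coordinate, making every defining equation of `D₃(k,q)`
homogeneous. -/
def weight (j : ℕ) : ℕ := if j = 0 then 1 else j / 2 + 2

lemma weight_aIdx_add_weight_bIdx {j : ℕ} (hj : 1 ≤ j) :
    weight (aIdx j) + weight (bIdx j) = weight j := by
  unfold aIdx bIdx
  split <;> simp only [weight] <;> split_ifs <;> grind

/-- Multiply the `j`-th coordinate by `t ^ weight j`. -/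
def weightedScale {k : ℕ} {F : Type*} [Field F] (t : F) (ht : t ≠ 0) :
    (Fin k → F) ≃ (Fin k → F) :=
  Equiv.piCongrRight fun i => Equiv.mulLeft₀ (t ^ weight i) (pow_ne_zero _ ht)

lemma ext_weightedScale {k : ℕ} {F : Type*} [Field F] (t : F) (ht : t ≠ 0) (a : Fin k → F)
    (j : ℕ) : ext (weightedScale t ht a) j = t ^ weight j * ext a j := by
  unfold ext weightedScale
  split <;> simp

lemma D3rel_weightedScale {k : ℕ} {F : Type*} [Field F] (t : F) (ht : t ≠ 0)
    (a b c : Fin k → F) :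
    D3rel k F (weightedScale t ht a) (weightedScale t ht b) (weightedScale t ht c) ↔
      D3rel k F a b c := by
  unfold D3rel
  refine forall₃_congr fun j hj _ => ?_
  simp only [ext_weightedScale]
  rw [← weight_aIdx_add_weight_bIdx hj, ← mul_eq_zero_iff_left
    (pow_ne_zero (weight (aIdx j) + weight (bIdx j)) ht)
    (b := ext a j + ext b j + ext c j + _ + _ + _), pow_add]
  ring_nf

/-- Weighted scaling maps the link of `v` in part `A` isomorphically onto the link of the
scaled vector. -/
def linkD3WeightedScaleIso {k : ℕ} {F : Type*} [Field F] (t : F) (ht : t ≠ 0) (v : Fin k → F) :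
    linkD3 k F 0 v ≃g linkD3 k F 0 (weightedScale t ht v) where
  toEquiv := Equiv.sumCongr (weightedScale t ht) (weightedScale t ht)
  map_rel_iff' := by
    rintro (x | x) (y | y) <;>
      simp [linkD3, D3edgeProp, SimpleGraph.fromRel_adj, D3rel_weightedScale]

/-- For `k ≥ 2`, a prime power `q` divisible by 3 and `a₁ ≠ 0`, the link of
`(a₁, 0, …, 0)` in part `A` of `D₃(k,q)` is isomorphic to the link of `(1, 0, …, 0)` in `A`. -/
theorem D3_link_a1_iso_link_one (k : ℕ) (hk : 2 ≤ k) (F : Type) [Field F] [Fintype F]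
    (hq : 3 ∣ Fintype.card F) (a₁ : F) (ha₁ : a₁ ≠ 0) :
    Nonempty
      (linkD3 k F 0 (fun i => if (i : ℕ) = 0 then a₁ else 0)
        ≃g linkD3 k F 0 (fun i => if (i : ℕ) = 0 then 1 else 0)) := by
  have h : weightedScale a₁ ha₁ (fun i : Fin k => if (i : ℕ) = 0 then 1 else 0) =
      fun i : Fin k => if (i : ℕ) = 0 then a₁ else 0 := by
    funext i
    by_cases hi : (i : ℕ) = 0 <;> simp [weightedScale, weight, hi]
  exact ⟨h ▸ (linkD3WeightedScaleIso a₁ ha₁ _).symm⟩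

end Paper
end

section
/- Let k ≥ 2 and let q be a prime power divisible by 3. In the 3-partite 3-uniform hypergraph D_3(k,q), the link of the vertex (1, 0, …, 0) in part C is isomorphic to the bipartite graph D'(k,q); an isomorphism is given by mapping each vertex of D'(k,q) to the vector obtained by adding 1 to its first coordinate and leaving all other coordinates unchanged. -/
open scoped Classical

namespace Paper

/-- Add `1` to the first coordinate of a vector. -/
def shift1 {k : ℕ} {F : Type*} [CommRing F] (a : Fin k → F) : Fin k → F :=
  fun i => if (i : ℕ) = 0 then a i + 1 else a i

theorem ext_shift1_zero {k : ℕ} {F : Type*} [CommRing F] (hk : 0 < k) (a : Fin k → F) :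
    ext (shift1 a) 0 = ext a 0 + 1 := by
  simp [ext, shift1, hk]

theorem ext_shift1_of_ne_zero {k : ℕ} {F : Type*} [CommRing F] (a : Fin k → F) {j : ℕ}
    (hj : j ≠ 0) : ext (shift1 a) j = ext a j := by
  simp [ext, shift1, hj]

theorem shift1_bijective {k : ℕ} {F : Type*} [CommRing F] :
    Function.Bijective (shift1 (k := k) (F := F)) := by
  refine Function.bijective_iff_has_inverse.mpr
    ⟨fun a i => if (i : ℕ) = 0 then a i - 1 else a i, fun a => ?_, fun a => ?_⟩ <;>
  · funext i
    by_cases h : (i : ℕ) = 0 <;> simp [shift1, h]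

/-- From the second equation on, one factor of the product term has index `0` and the other
has the index of the linear term. -/
theorem aIdx_bIdx_cases {j : ℕ} (hj : 2 ≤ j) :
    linIdx j ≠ 0 ∧ ((aIdx j = 0 ∧ bIdx j = linIdx j) ∨ (aIdx j = linIdx j ∧ bIdx j = 0)) := by
  match j, hj with
  | 2, _ => simp [linIdx, aIdx, bIdx]
  | 3, _ => simp [linIdx, aIdx, bIdx]
  | n + 4, _ =>
    simp only [linIdx, aIdx, bIdx]
    split_ifs <;> simp

theorem three_eq_zero_of_dvd_card {F : Type*} [Field F] [Fintype F]
    (hq : 3 ∣ Fintype.card F) : (3 : F) = 0 := by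
  obtain ⟨p, hp⟩ := CharP.exists F
  obtain ⟨n, hprime, hn⟩ := FiniteField.card F p
  rw [hn] at hq
  have h3 : 3 = p := (Nat.prime_dvd_prime_iff_eq Nat.prime_three hprime).mp
    (Nat.prime_three.dvd_of_dvd_pow hq)
  subst h3
  exact_mod_cast CharP.cast_eq_zero F 3

theorem D3rel_shift1_iff {k : ℕ} (hk : 0 < k) {F : Type*} [CommRing F] (h3 : (3 : F) = 0)
    (a b : Fin k → F) :
    D3rel k F (shift1 a) (shift1 b) (fun i => if (i : ℕ) = 0 then 1 else 0) ↔
      D'rel k F a b := by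
  have hc0 : ext (fun i : Fin k => if (i : ℕ) = 0 then (1 : F) else 0) 0 = 1 := by
    simp [ext, hk]
  have hc : ∀ j, j ≠ 0 → ext (fun i : Fin k => if (i : ℕ) = 0 then (1 : F) else 0) j = 0 := by
    intro j hj
    simp [ext, hj]
  refine forall_congr' fun j => forall_congr' fun hj1 => forall_congr' fun _ => ?_
  have hj0 : j ≠ 0 := by omega
  rw [ext_shift1_of_ne_zero a hj0, ext_shift1_of_ne_zero b hj0, hc j hj0]
  by_cases hj : j = 1
  · subst hj
    simp only [aIdx, bIdx, ext_shift1_zero hk, hc0, if_true]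
    refine Eq.congr_left ?_
    linear_combination (ext a 0 + ext b 0 + 1) * h3
  · rw [if_neg hj]
    obtain ⟨hl, ⟨h1, h2⟩ | ⟨h1, h2⟩⟩ := aIdx_bIdx_cases (show 2 ≤ j by omega) <;>
    · simp only [h1, h2, ext_shift1_zero hk, ext_shift1_of_ne_zero _ hl, hc _ hl, hc0]
      refine Eq.congr_left ?_
      ring

/-- For `k ≥ 2` and a prime power `q` divisible by 3, the link of
`(1, 0, …, 0)` in part `C` of `D₃(k,q)` is isomorphic to `D'(k,q)`, an isomorphism being given
on each part by adding `1` to the first coordinate. -/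
theorem D3_link_one_iso_D' (k : ℕ) (hk : 2 ≤ k) (F : Type) [Field F] [Fintype F]
    (hq : 3 ∣ Fintype.card F) :
    Function.Bijective (Sum.map (shift1 (k := k) (F := F)) (shift1 (k := k) (F := F))) ∧
    ∀ x y : (Fin k → F) ⊕ (Fin k → F),
      (D'Graph k F).Adj x y ↔
        (linkD3 k F 2 (fun i => if (i : ℕ) = 0 then 1 else 0)).Adj
          (Sum.map shift1 shift1 x) (Sum.map shift1 shift1 y) := by
  have h := D3rel_shift1_iff (show 0 < k by omega) (three_eq_zero_of_dvd_card hq)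
  refine ⟨shift1_bijective.sumMap shift1_bijective, ?_⟩
  rintro (a | a) (b | b) <;>
    simp [D'Graph, linkD3, D3edgeProp, SimpleGraph.fromRel_adj, h]

end Paper
end

section
/- For every prime power q and every integer k with 2 ≤ k ≤ 6, the bipartite graphs D'(k,q) and D(k,q) are isomorphic. In particular, for k = 6 an isomorphism is given by the coordinate map sending (a_1, a_{11}, a_{12}, a_{21}, a_{22}, a'_{22}) to (a_1, a_{11}−a_1, a_{12}+a_1, a_{21}+a_1, a_{22}+a_{12}+a_{11}−a_1, a'_{22}+a_{21}+a_{11}−a_1) on each part. -/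
open scoped Classical

namespace Paper

/-- The explicit coordinate change witnessing `D'(6,q) ≅ D(6,q)`. -/
def psi6 {F : Type*} [CommRing F] (x : Fin 6 → F) : Fin 6 → F :=
  ![x 0, x 1 - x 0, x 2 + x 0, x 3 + x 0,
    x 4 + x 2 + x 1 - x 0, x 5 + x 3 + x 1 - x 0]

/-- The coordinate change `psi6` on sequences, extended by the identity beyond index `5`. -/
def coordChange {F : Type*} [CommRing F] (x : ℕ → F) : ℕ → F
  | 0 => x 0
  | 1 => x 1 - x 0
  | 2 => x 2 + x 0
  | 3 => x 3 + x 0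
  | 4 => x 4 + x 2 + x 1 - x 0
  | 5 => x 5 + x 3 + x 1 - x 0
  | j => x j

/-- The inverse of `coordChange`. -/
def coordChangeInv {F : Type*} [CommRing F] (y : ℕ → F) : ℕ → F
  | 0 => y 0
  | 1 => y 1 + y 0
  | 2 => y 2 - y 0
  | 3 => y 3 - y 0
  | 4 => y 4 - y 2 - y 1 + y 0
  | 5 => y 5 - y 3 - y 1 + y 0
  | j => y j

lemma ext_of_lt {k : ℕ} {F : Type*} [Zero F] (f : ℕ → F) {j : ℕ} (h : j < k) :
    ext (fun i : Fin k => f i) j = f j := by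
  simp [ext, h]

lemma ext_val {k : ℕ} {F : Type*} [Zero F] (x : Fin k → F) (i : Fin k) : ext x i = x i := by
  simp [ext]

lemma coordChangeInv_congr {F : Type*} [CommRing F] {y z : ℕ → F} {j : ℕ}
    (h : ∀ i ≤ j, y i = z i) : coordChangeInv y j = coordChangeInv z j := by
  unfold coordChangeInv
  split <;> simp [h]

lemma coordChange_congr {F : Type*} [CommRing F] {y z : ℕ → F} {j : ℕ}
    (h : ∀ i ≤ j, y i = z i) : coordChange y j = coordChange z j := by
  unfold coordChange
  split <;> simp [h]

lemma coordChangeInv_coordChange {F : Type*} [CommRing F] (x : ℕ → F) (j : ℕ) :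
    coordChangeInv (coordChange x) j = x j := by
  rcases j with _ | _ | _ | _ | _ | _ | j <;> simp only [coordChange, coordChangeInv] <;> ring

lemma coordChange_coordChangeInv {F : Type*} [CommRing F] (x : ℕ → F) (j : ℕ) :
    coordChange (coordChangeInv x) j = x j := by
  rcases j with _ | _ | _ | _ | _ | _ | j <;> simp only [coordChange, coordChangeInv] <;> ring

/-- The truncation of `coordChange` to the first `k` coordinates, as an equivalence. -/
def coordEquiv (k : ℕ) (F : Type*) [CommRing F] : (Fin k → F) ≃ (Fin k → F) where
  toFun x i := coordChange (ext x) i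
  invFun y i := coordChangeInv (ext y) i
  left_inv x := by
    funext i
    exact (coordChangeInv_congr fun j hj =>
      ext_of_lt (coordChange (ext x)) (hj.trans_lt i.isLt)).trans
      ((coordChangeInv_coordChange _ _).trans (ext_val x i))
  right_inv y := by
    funext i
    exact (coordChange_congr fun j hj =>
      ext_of_lt (coordChangeInv (ext y)) (hj.trans_lt i.isLt)).trans
      ((coordChange_coordChangeInv _ _).trans (ext_val y i))

lemma ext_coordEquiv {k : ℕ} {F : Type*} [CommRing F] (x : Fin k → F) {j : ℕ} (h : j < k) :
    ext (coordEquiv k F x) j = coordChange (ext x) j :=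
  ext_of_lt (coordChange (ext x)) h

lemma coe_coordEquiv_six (F : Type*) [CommRing F] : ⇑(coordEquiv 6 F) = psi6 := by
  funext x i
  fin_cases i <;> rfl

/-- Up to index `5`, each equation of `D` after the coordinate change is a combination of the
corresponding equation of `D'` and the first one. -/
lemma D'rel_iff_Drel_coordEquiv {k : ℕ} {F : Type*} [CommRing F] (hk : k ≤ 6)
    (a b : Fin k → F) :
    D'rel k F a b ↔ Drel k F (coordEquiv k F a) (coordEquiv k F b) := by
  constructor
  · intro h j hj hjk
    have h1 := h 1 le_rfl (by omega)
    have hh := h j hj hjk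
    have hj6 : j < 6 := by omega
    interval_cases j <;>
      norm_num [aIdx, bIdx, linIdx] at h1 hh ⊢ <;>
      simp (disch := omega) only [ext_coordEquiv, coordChange] <;>
      first
      | linear_combination hh
      | linear_combination hh + h1
      | linear_combination hh - h1
  · intro h j hj hjk
    have h1 := h 1 le_rfl (by omega)
    have hh := h j hj hjk
    have hj6 : j < 6 := by omega
    interval_cases j <;>
      norm_num [aIdx, bIdx, linIdx] at h1 hh ⊢ <;>
      simp (disch := omega) only [ext_coordEquiv, coordChange] at h1 hh <;>
      first
      | linear_combination hh
      | linear_combination hh + h1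
      | linear_combination hh - h1

lemma D'Graph_adj_iff {k : ℕ} {F : Type*} [CommRing F] (hk : k ≤ 6)
    (x y : (Fin k → F) ⊕ (Fin k → F)) :
    (D'Graph k F).Adj x y ↔ (DGraph k F).Adj
      (Sum.map (coordEquiv k F) (coordEquiv k F) x)
      (Sum.map (coordEquiv k F) (coordEquiv k F) y) := by
  rcases x with x | x <;> rcases y with y | y <;>
    simp [D'Graph, DGraph, D'rel_iff_Drel_coordEquiv hk]

/-- For every prime power `q` and `2 ≤ k ≤ 6`, `D'(k,q) ≅ D(k,q)`; for `k = 6`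
an isomorphism is given on each part by
`(a₁, a₁₁, a₁₂, a₂₁, a₂₂, a'₂₂) ↦ (a₁, a₁₁−a₁, a₁₂+a₁, a₂₁+a₁, a₂₂+a₁₂+a₁₁−a₁, a'₂₂+a₂₁+a₁₁−a₁)`. -/
theorem D'_iso_D (F : Type) [Field F] [Fintype F] :
    (∀ k : ℕ, 2 ≤ k → k ≤ 6 → Nonempty (D'Graph k F ≃g DGraph k F)) ∧
    Function.Bijective (Sum.map (psi6 (F := F)) (psi6 (F := F))) ∧
    (∀ x y : (Fin 6 → F) ⊕ (Fin 6 → F),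
      (D'Graph 6 F).Adj x y ↔
        (DGraph 6 F).Adj (Sum.map psi6 psi6 x) (Sum.map psi6 psi6 y)) := by
  refine ⟨fun k _ hk => ⟨⟨Equiv.sumCongr (coordEquiv k F) (coordEquiv k F), ?_⟩⟩, ?_, ?_⟩
  · exact fun {x y} => (D'Graph_adj_iff hk x y).symm
  · rw [← coe_coordEquiv_six]
    exact (Equiv.sumCongr (coordEquiv 6 F) (coordEquiv 6 F)).bijective
  · rw [← coe_coordEquiv_six]
    exact D'Graph_adj_iff le_rfl

end Paper
end

section
/- The bipartite graphs D'(11,3) and D(11,3) are not isomorphic. -/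
open scoped Classical

namespace Paper

/-! ### Endpoints of walks of a given length -/

/-- The set of endpoints of the walks of length `n` that start at `v`. -/
def walkEnds {V : Type*} (G : SimpleGraph V) (v : V) : ℕ → Set V
  | 0 => {v}
  | n + 1 => {w | ∃ u ∈ walkEnds G v n, G.Adj u w}

lemma ncard_walkEnds_le {V W : Type*} [Finite W] {G : SimpleGraph V} {H : SimpleGraph W}
    {f : V → W} (hinj : Function.Injective f) (hadj : ∀ u v, G.Adj u v → H.Adj (f u) (f v))
    (v : V) (n : ℕ) : (walkEnds G v n).ncard ≤ (walkEnds H (f v) n).ncard := by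
  have hsub : ∀ w ∈ walkEnds G v n, f w ∈ walkEnds H (f v) n := by
    induction n with
    | zero =>
      intro w hw
      have hw' : w = v := hw
      rw [hw']
      exact Set.mem_singleton _
    | succ n ih =>
      rintro w ⟨u, hu, huw⟩
      exact ⟨f u, ih u hu, hadj u w huw⟩
  exact Set.ncard_le_ncard_of_injOn f hsub hinj.injOn (Set.toFinite _)

/-! ### Sorting and removing duplicates -/

/-- Evaluate `f n` after reducing `n` to a numeral. -/
def force {α : Type} : ℕ → (ℕ → α) → α
  | 0, f => f 0
  | n + 1, f => f (n + 1)

lemma force_eq {α : Type} (n : ℕ) (f : ℕ → α) : force n f = f n := by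
  cases n <;> rfl

/-- Binary trees with labels in `ℕ`. -/
inductive NatTree
  | nil : NatTree
  | node (l : NatTree) (k : ℕ) (r : NatTree) : NatTree

namespace NatTree

/-- Insertion into a binary search tree. The result is passed to the continuation `f` in normal
form, which keeps the evaluation by the kernel shallow. -/
def insert {α : Type} (a : ℕ) : NatTree → (NatTree → α) → α
  | nil, f => f (node nil a nil)
  | node l k r, f =>
    bif Nat.ble a k then
      (bif Nat.beq a k then f (node l k r) else l.insert a fun l' => f (node l' k r))
    else r.insert a fun new => f (node l k new)

/-- Insertion of all entries of a list into a binary search tree, with a continuation. -/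
def insertAll {α : Type} : List ℕ → NatTree → (NatTree → α) → α
  | [], t, f => f t
  | a :: l, t, f => force a fun m => t.insert m fun new => insertAll l new f

/-- The labels of a tree, in order, followed by a given list. -/
def toListAppend : NatTree → List ℕ → List ℕ
  | nil, acc => acc
  | node l k r, acc => l.toListAppend (k :: r.toListAppend acc)

/-- Membership of a label in a tree. -/
def Mem (x : ℕ) : NatTree → Prop
  | nil => False
  | node l k r => l.Mem x ∨ x = k ∨ r.Mem x

lemma insert_eq {α : Type} (a : ℕ) (t : NatTree) (f : NatTree → α) :
    t.insert a f = f (t.insert a id) := by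
  induction t generalizing α f with
  | nil => rfl
  | node l k r ihl ihr =>
    simp only [insert]
    cases Nat.ble a k
    · simp only [cond_false]
      exact (ihr _).trans (congrArg f (ihr fun r' => node l k r').symm)
    · cases Nat.beq a k
      · simp only [cond_true, cond_false]
        exact (ihl _).trans (congrArg f (ihl fun l' => node l' k r).symm)
      · rfl

lemma mem_insert (x a : ℕ) (t : NatTree) : (t.insert a id).Mem x ↔ x = a ∨ t.Mem x := by
  induction t with
  | nil => simp [insert, Mem]
  | node l k r ihl ihr =>
    rw [insert]
    cases h : Nat.ble a k
    · rw [cond_false, insert_eq]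
      simp only [Mem, id, ihr]
      tauto
    · cases h' : Nat.beq a k
      · rw [cond_true, cond_false, insert_eq]
        simp only [Mem, id, ihl]
        tauto
      · have := Nat.eq_of_beq_eq_true h'
        simp only [cond_true, id, Mem, this]
        tauto

lemma insertAll_eq {α : Type} (l : List ℕ) (t : NatTree) (f : NatTree → α) :
    insertAll l t f = f (insertAll l t id) := by
  induction l generalizing t with
  | nil => rfl
  | cons a l ih =>
    simp only [insertAll, force_eq]
    rw [insert_eq, insert_eq a t fun t' => insertAll l t' id, ih]

lemma mem_insertAll (x : ℕ) (l : List ℕ) (t : NatTree) :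
    (insertAll l t id).Mem x ↔ x ∈ l ∨ t.Mem x := by
  induction l generalizing t with
  | nil => simp [insertAll]
  | cons a l ih =>
    rw [insertAll, force_eq, insert_eq, ih, mem_insert, List.mem_cons]
    tauto

lemma mem_toListAppend (x : ℕ) (t : NatTree) (acc : List ℕ) :
    x ∈ t.toListAppend acc ↔ t.Mem x ∨ x ∈ acc := by
  induction t generalizing acc with
  | nil => simp [toListAppend, Mem]
  | node l k r ihl ihr =>
    simp only [toListAppend, Mem, ihl, ihr, List.mem_cons]
    tauto

end NatTree

/-- The increasing list of the distinct entries of a list. -/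
def sortDedup (l : List ℕ) : List ℕ :=
  NatTree.insertAll l NatTree.nil fun t => t.toListAppend []

lemma mem_sortDedup (x : ℕ) (l : List ℕ) : x ∈ sortDedup l ↔ x ∈ l := by
  rw [sortDedup, NatTree.insertAll_eq, NatTree.mem_toListAppend, NatTree.mem_insertAll]
  simp [NatTree.Mem]

/-- Whether a list has a given length. -/
def hasLength : List ℕ → ℕ → Bool
  | [], 0 => true
  | _ :: l, n + 1 => hasLength l n
  | _, _ => false

lemma length_of_hasLength {l : List ℕ} {n : ℕ} (h : hasLength l n = true) : l.length = n := by
  induction l generalizing n with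
  | nil =>
    cases n
    · rfl
    · simp [hasLength] at h
  | cons a l ih =>
    cases n
    · simp [hasLength] at h
    · rw [List.length_cons, ih h]

/-- Whether a list is strictly increasing of a given length with entries in `[a, b)`. -/
def increasingIn (b : ℕ) : ℕ → List ℕ → ℕ → Bool
  | _, [], 0 => true
  | a, x :: l, n + 1 => Nat.ble a x && (Nat.blt x b && increasingIn b (x + 1) l n)
  | _, _, _ => false

lemma increasingIn_spec {a b n : ℕ} {l : List ℕ} (h : increasingIn b a l n = true) :
    l.length = n ∧ l.Nodup ∧ ∀ x ∈ l, a ≤ x ∧ x < b := by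
  induction l generalizing a n with
  | nil =>
    cases n
    · simp
    · simp [increasingIn] at h
  | cons x l ih =>
    cases n with
    | zero => simp [increasingIn] at h
    | succ n =>
      simp only [increasingIn, Bool.and_eq_true, Nat.ble_eq, Nat.blt_eq] at h
      obtain ⟨hax, hxb, hl⟩ := h
      obtain ⟨hlen, hnd, hmem⟩ := ih hl
      refine ⟨by rw [List.length_cons, hlen], List.nodup_cons.2 ⟨fun hx => ?_, hnd⟩, ?_⟩
      · have := (hmem x hx).1
        omega
      · intro y hy
        rcases List.mem_cons.1 hy with rfl | hy
        · exact ⟨hax, hxb⟩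
        · have := hmem y hy
          omega

/-! ### Walk endpoints in terms of codes of vertices -/

/-- The codes of the endpoints of the walks of length `n` from the vertex with code `0`, when
`step i x` lists the codes of the neighbours at time `i + 1` of the vertex with code `x`. -/
def level (step : ℕ → ℕ → List ℕ) : ℕ → List ℕ
  | 0 => [0]
  | n + 1 => sortDedup ((level step n).flatMap (step n))

lemma walkEnds_eq_image_level {V : Type*} {G : SimpleGraph V} {vert : ℕ → ℕ → V}
    {step : ℕ → ℕ → List ℕ}
    (h : ∀ n x w, G.Adj (vert n x) w ↔ ∃ y ∈ step n x, w = vert (n + 1) y) (n : ℕ) :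
    walkEnds G (vert 0 0) n = vert n '' {x | x ∈ level step n} := by
  induction n with
  | zero => simp [walkEnds, level]
  | succ n ih =>
    apply Set.ext
    intro w
    simp only [walkEnds, ih, level, Set.mem_ofPred_eq, Set.mem_image, mem_sortDedup,
      List.mem_flatMap]
    constructor
    · rintro ⟨u, ⟨x, hx, rfl⟩, hw⟩
      obtain ⟨y, hy, rfl⟩ := (h n x w).1 hw
      exact ⟨y, ⟨x, hx, hy⟩, rfl⟩
    · rintro ⟨y, ⟨x, hx, hy⟩, rfl⟩
      exact ⟨vert n x, ⟨x, hx, rfl⟩, (h n x _).2 ⟨y, hy, rfl⟩⟩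

lemma ncard_walkEnds_le_length {V : Type*} {G : SimpleGraph V} {vert : ℕ → ℕ → V}
    {step : ℕ → ℕ → List ℕ}
    (h : ∀ n x w, G.Adj (vert n x) w ↔ ∃ y ∈ step n x, w = vert (n + 1) y) (n : ℕ) :
    (walkEnds G (vert 0 0) n).ncard ≤ (level step n).length := by
  have hset : {x | x ∈ level step n} = ((level step n).toFinset : Set ℕ) := by
    apply Set.ext
    simp
  rw [walkEnds_eq_image_level h, hset]
  refine (Set.ncard_image_le (Finset.finite_toSet _)).trans ?_
  rw [Set.ncard_coe_finset]
  exact List.toFinset_card_le _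

lemma le_ncard_walkEnds {V : Type*} {G : SimpleGraph V} {vert : ℕ → ℕ → V}
    {step : ℕ → ℕ → List ℕ}
    (h : ∀ n x w, G.Adj (vert n x) w ↔ ∃ y ∈ step n x, w = vert (n + 1) y) {n b m : ℕ}
    (hinj : Set.InjOn (vert n) (Set.Iio b)) (hl : increasingIn b 0 (level step n) m = true) :
    m ≤ (walkEnds G (vert 0 0) n).ncard := by
  obtain ⟨hlen, hnd, hmem⟩ := increasingIn_spec hl
  have hset : {x | x ∈ level step n} = ((level step n).toFinset : Set ℕ) := by
    apply Set.ext
    simp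
  have hinj' : Set.InjOn (vert n) ((level step n).toFinset : Set ℕ) :=
    hinj.mono fun x hx => (hmem x (by simpa using hx)).2
  rw [walkEnds_eq_image_level h, hset, hinj'.ncard_image, Set.ncard_coe_finset,
    List.toFinset_card_of_nodup hnd, hlen]

/-! ### Codes of vectors over `ZMod 3` -/

/-- The vector of the lowest `k` digits of `n` in base 3. -/
def ofCode (k n : ℕ) : Fin k → ZMod 3 := fun j => ((n / 3 ^ (j : ℕ) : ℕ) : ZMod 3)

/-- The number whose base 3 digits, lowest first, are the given numbers modulo 3. -/
def toCode : List ℕ → ℕ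
  | [] => 0
  | d :: l => d % 3 + 3 * toCode l

lemma cast_toCode_div (l : List ℕ) (j : ℕ) :
    ((toCode l / 3 ^ j : ℕ) : ZMod 3) = (l.getD j 0 : ℕ) := by
  induction l generalizing j with
  | nil => simp [toCode]
  | cons d l ih =>
    cases j with
    | zero =>
      have h3 : (3 : ZMod 3) = 0 := rfl
      simp [toCode, h3]
    | succ j =>
      have hdiv : (d % 3 + 3 * toCode l) / 3 = toCode l := by omega
      rw [toCode, pow_succ', ← Nat.div_div_eq_div_mul, hdiv, ih, List.getD_cons_succ]

lemma ofCode_injOn (k : ℕ) : Set.InjOn (ofCode k) (Set.Iio (3 ^ k)) := by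
  induction k with
  | zero =>
    intro m hm n hn _
    simp only [pow_zero, Set.mem_Iio] at hm hn
    omega
  | succ k ih =>
    intro m hm n hn hmn
    simp only [pow_succ', Set.mem_Iio] at hm hn
    have h0 : m % 3 = n % 3 := by
      have := congrFun hmn 0
      simpa [ofCode, ZMod.natCast_eq_natCast_iff'] using this
    have hdiv : m / 3 = n / 3 := by
      refine ih (Set.mem_Iio.2 (by omega)) (Set.mem_Iio.2 (by omega)) (funext fun j => ?_)
      have := congrFun hmn j.succ
      simpa [ofCode, pow_succ', ← Nat.div_div_eq_div_mul] using this
    omega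

/-- The vertex with code `x` in the part `A` (for even `n`) or `B` (for odd `n`). -/
def codeVertex (n x : ℕ) : (Fin 11 → ZMod 3) ⊕ (Fin 11 → ZMod 3) :=
  bif n.bodd then Sum.inr (ofCode 11 x) else Sum.inl (ofCode 11 x)

lemma codeVertex_zero_zero : codeVertex 0 0 = Sum.inl 0 := by
  simp [codeVertex, funext_iff, ofCode]

lemma codeVertex_one_zero : codeVertex 1 0 = Sum.inr 0 := by
  simp [codeVertex, funext_iff, ofCode]

lemma codeVertex_ten_injOn : Set.InjOn (codeVertex 10) (Set.Iio (3 ^ 11)) := by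
  intro m hm n hn hmn
  exact ofCode_injOn 11 hm hn (Sum.inl_injective hmn)

/-- The codes of the neighbours, alternating between the two parts, when the coordinates of the
neighbour with first coordinate `c` are given by `fromA x c` and `fromB x c`. -/
def stepOf (fromA fromB : (ℕ → ℕ) → ℕ → List ℕ) (n x : ℕ) : List ℕ :=
  [0, 1, 2].map fun c => toCode ((bif n.bodd then fromB else fromA) (fun j => x / 3 ^ j) c)

/-! ### The equations in explicit form -/

section Explicit

variable {R : Type*} [CommRing R]

lemma Drel_eleven_iff (a b : Fin 11 → R) : Drel 11 R a b ↔
    a 1 + b 1 + a 0 * b 0 = 0 ∧ a 2 + b 2 + a 0 * b 1 = 0 ∧ a 3 + b 3 + a 1 * b 0 = 0 ∧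
    a 4 + b 4 + a 2 * b 0 = 0 ∧ a 5 + b 5 + a 0 * b 3 = 0 ∧ a 6 + b 6 + a 0 * b 4 = 0 ∧
    a 7 + b 7 + a 5 * b 0 = 0 ∧ a 8 + b 8 + a 6 * b 0 = 0 ∧ a 9 + b 9 + a 0 * b 7 = 0 ∧
    a 10 + b 10 + a 0 * b 8 = 0 := by
  constructor
  · intro h
    exact ⟨h 1 (by norm_num) (by norm_num), h 2 (by norm_num) (by norm_num),
      h 3 (by norm_num) (by norm_num), h 4 (by norm_num) (by norm_num),
      h 5 (by norm_num) (by norm_num), h 6 (by norm_num) (by norm_num),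
      h 7 (by norm_num) (by norm_num), h 8 (by norm_num) (by norm_num),
      h 9 (by norm_num) (by norm_num), h 10 (by norm_num) (by norm_num)⟩
  · rintro ⟨h1, h2, h3, h4, h5, h6, h7, h8, h9, h10⟩ j hj hj'
    interval_cases j <;> assumption

lemma D'rel_eleven_iff (a b : Fin 11 → R) : D'rel 11 R a b ↔
    a 1 - a 0 + b 1 - b 0 + a 0 * b 0 = 0 ∧
    a 2 + a 1 + b 2 + b 1 + a 0 * b 1 = 0 ∧ a 3 + a 1 + b 3 + b 1 + a 1 * b 0 = 0 ∧
    a 4 + a 2 + b 4 + b 2 + a 2 * b 0 = 0 ∧ a 5 + a 3 + b 5 + b 3 + a 0 * b 3 = 0 ∧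
    a 6 + a 4 + b 6 + b 4 + a 0 * b 4 = 0 ∧ a 7 + a 5 + b 7 + b 5 + a 5 * b 0 = 0 ∧
    a 8 + a 6 + b 8 + b 6 + a 6 * b 0 = 0 ∧ a 9 + a 7 + b 9 + b 7 + a 0 * b 7 = 0 ∧
    a 10 + a 8 + b 10 + b 8 + a 0 * b 8 = 0 := by
  constructor
  · intro h
    have h1 := h 1 (by norm_num) (by norm_num)
    rw [if_pos rfl] at h1
    have h' : ∀ j, 2 ≤ j → j < 11 → ext a j + ext a (linIdx j) + ext b j + ext b (linIdx j)
        + ext a (aIdx j) * ext b (bIdx j) = 0 := by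
      intro j hj hj'
      have := h j (by omega) hj'
      rwa [if_neg (by omega)] at this
    exact ⟨h1, h' 2 (by norm_num) (by norm_num),
      h' 3 (by norm_num) (by norm_num), h' 4 (by norm_num) (by norm_num),
      h' 5 (by norm_num) (by norm_num), h' 6 (by norm_num) (by norm_num),
      h' 7 (by norm_num) (by norm_num), h' 8 (by norm_num) (by norm_num),
      h' 9 (by norm_num) (by norm_num), h' 10 (by norm_num) (by norm_num)⟩
  · rintro ⟨h1, h2, h3, h4, h5, h6, h7, h8, h9, h10⟩ j hj hj'
    split_ifs with h
    · exact h1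
    · interval_cases j <;> first | assumption | exact absurd rfl h

end Explicit

/-- Two vectors with 11 coordinates agree if their coordinates agree one by one. -/
lemma eq_of_eleven {α : Type*} {x y : Fin 11 → α} (h0 : x 0 = y 0) (h1 : x 1 = y 1)
    (h2 : x 2 = y 2) (h3 : x 3 = y 3) (h4 : x 4 = y 4) (h5 : x 5 = y 5) (h6 : x 6 = y 6)
    (h7 : x 7 = y 7) (h8 : x 8 = y 8) (h9 : x 9 = y 9) (h10 : x 10 = y 10) : x = y := by
  funext j
  fin_cases j <;> assumption

/-! ### Neighbours in `D(11, 3)` and `D'(11, 3)` -/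

/-- The coordinates of the neighbour in `B` with first coordinate `c` of the vertex `x` of `A`
in `D(11, 3)`. -/
def nbrFromA (x : ℕ → ℕ) (c : ℕ) : List ℕ :=
  let y1 := 2 * (x 1 + x 0 * c)
  let y2 := 2 * (x 2 + x 0 * y1)
  let y3 := 2 * (x 3 + x 1 * c)
  let y4 := 2 * (x 4 + x 2 * c)
  let y5 := 2 * (x 5 + x 0 * y3)
  let y6 := 2 * (x 6 + x 0 * y4)
  let y7 := 2 * (x 7 + x 5 * c)
  let y8 := 2 * (x 8 + x 6 * c)
  let y9 := 2 * (x 9 + x 0 * y7)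
  let y10 := 2 * (x 10 + x 0 * y8)
  [c, y1, y2, y3, y4, y5, y6, y7, y8, y9, y10]

/-- The coordinates of the neighbour in `A` with first coordinate `c` of the vertex `x` of `B`
in `D(11, 3)`. -/
def nbrFromB (x : ℕ → ℕ) (c : ℕ) : List ℕ :=
  let y1 := 2 * (x 1 + c * x 0)
  let y2 := 2 * (x 2 + c * x 1)
  let y3 := 2 * (x 3 + y1 * x 0)
  let y4 := 2 * (x 4 + y2 * x 0)
  let y5 := 2 * (x 5 + c * x 3)
  let y6 := 2 * (x 6 + c * x 4)
  let y7 := 2 * (x 7 + y5 * x 0)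
  let y8 := 2 * (x 8 + y6 * x 0)
  let y9 := 2 * (x 9 + c * x 7)
  let y10 := 2 * (x 10 + c * x 8)
  [c, y1, y2, y3, y4, y5, y6, y7, y8, y9, y10]

/-- The coordinates of the neighbour in `B` with first coordinate `c` of the vertex `x` of `A`
in `D'(11, 3)`. -/
def nbrFromA' (x : ℕ → ℕ) (c : ℕ) : List ℕ :=
  let y1 := 2 * (x 1 + 2 * x 0 + 2 * c + x 0 * c)
  let y2 := 2 * (x 2 + x 1 + y1 + x 0 * y1)
  let y3 := 2 * (x 3 + x 1 + y1 + x 1 * c)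
  let y4 := 2 * (x 4 + x 2 + y2 + x 2 * c)
  let y5 := 2 * (x 5 + x 3 + y3 + x 0 * y3)
  let y6 := 2 * (x 6 + x 4 + y4 + x 0 * y4)
  let y7 := 2 * (x 7 + x 5 + y5 + x 5 * c)
  let y8 := 2 * (x 8 + x 6 + y6 + x 6 * c)
  let y9 := 2 * (x 9 + x 7 + y7 + x 0 * y7)
  let y10 := 2 * (x 10 + x 8 + y8 + x 0 * y8)
  [c, y1, y2, y3, y4, y5, y6, y7, y8, y9, y10]

/-- The coordinates of the neighbour in `A` with first coordinate `c` of the vertex `x` of `B`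
in `D'(11, 3)`. -/
def nbrFromB' (x : ℕ → ℕ) (c : ℕ) : List ℕ :=
  let y1 := 2 * (x 1 + 2 * x 0 + 2 * c + c * x 0)
  let y2 := 2 * (x 2 + x 1 + y1 + c * x 1)
  let y3 := 2 * (x 3 + x 1 + y1 + y1 * x 0)
  let y4 := 2 * (x 4 + x 2 + y2 + y2 * x 0)
  let y5 := 2 * (x 5 + x 3 + y3 + c * x 3)
  let y6 := 2 * (x 6 + x 4 + y4 + c * x 4)
  let y7 := 2 * (x 7 + x 5 + y5 + y5 * x 0)
  let y8 := 2 * (x 8 + x 6 + y6 + y6 * x 0)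
  let y9 := 2 * (x 9 + x 7 + y7 + c * x 7)
  let y10 := 2 * (x 10 + x 8 + y8 + c * x 8)
  [c, y1, y2, y3, y4, y5, y6, y7, y8, y9, y10]


lemma hasLength_level_A : hasLength (level (stepOf nbrFromA nbrFromB) 10) 1993 = true := by
  decide +kernel

lemma hasLength_level_B :
    hasLength (level (fun n => stepOf nbrFromA nbrFromB (n + 1)) 10) 1993 = true := by
  decide +kernel

lemma increasingIn_level_A' :
    increasingIn 177147 0 (level (stepOf nbrFromA' nbrFromB') 10) 2023 = true := by
  decide +kernel

lemma adj_fromRel_inl {V : Type*} (r : V → V → Prop) (a : V) (w : V ⊕ V) :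
    (SimpleGraph.fromRel
      (fun x y => ∃ a b, x = Sum.inl a ∧ y = Sum.inr b ∧ r a b)).Adj (Sum.inl a) w ↔
      ∃ b, r a b ∧ w = Sum.inr b := by
  rw [SimpleGraph.fromRel_adj]
  constructor
  · rintro ⟨-, ⟨a', b, ha, rfl, h⟩ | ⟨a', b, -, hb, -⟩⟩
    · exact ⟨b, Sum.inl_injective ha ▸ h, rfl⟩
    · exact absurd hb Sum.inl_ne_inr
  · rintro ⟨b, h, rfl⟩
    exact ⟨Sum.inl_ne_inr, Or.inl ⟨a, b, rfl, rfl, h⟩⟩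

lemma adj_fromRel_inr {V : Type*} (r : V → V → Prop) (b : V) (w : V ⊕ V) :
    (SimpleGraph.fromRel
      (fun x y => ∃ a b, x = Sum.inl a ∧ y = Sum.inr b ∧ r a b)).Adj (Sum.inr b) w ↔
      ∃ a, r a b ∧ w = Sum.inl a := by
  rw [SimpleGraph.fromRel_adj]
  constructor
  · rintro ⟨-, ⟨a, b', ha, -, -⟩ | ⟨a, b', rfl, hb, h⟩⟩
    · exact absurd ha Sum.inr_ne_inl
    · exact ⟨a, Sum.inr_injective hb ▸ h, rfl⟩
  · rintro ⟨a, h, rfl⟩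
    exact ⟨Sum.inr_ne_inl, Or.inr ⟨a, b, rfl, rfl, h⟩⟩

lemma exists_mem_cast_eq (z : ZMod 3) : ∃ c ∈ [0, 1, 2], z = ((c : ℕ) : ZMod 3) := by
  revert z
  decide

lemma add_add_eq_zero_iff_right (x y z : ZMod 3) : x + y + z = 0 ↔ y = 2 * (x + z) := by
  revert x y z
  decide

lemma add_add_eq_zero_iff_left (x y z : ZMod 3) : x + y + z = 0 ↔ x = 2 * (y + z) := by
  revert x y z
  decide

lemma ofCode_toCode (k : ℕ) (l : List ℕ) :
    ofCode k (toCode l) = fun j : Fin k => ((l.getD j 0 : ℕ) : ZMod 3) :=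
  funext fun j => cast_toCode_div l j

lemma Drel_iff_nbrFromA (x : ℕ → ℕ) (b : Fin 11 → ZMod 3) :
    Drel 11 (ZMod 3) (fun j : Fin 11 => (x j : ZMod 3)) b ↔
      ∃ c ∈ [0, 1, 2], b = fun j : Fin 11 => (((nbrFromA x c).getD j 0 : ℕ) : ZMod 3) := by
  simp only [Drel_eleven_iff, add_add_eq_zero_iff_right]
  constructor
  · rintro ⟨h1, h2, h3, h4, h5, h6, h7, h8, h9, h10⟩
    obtain ⟨c, hc, h0⟩ := exists_mem_cast_eq (b 0)
    refine ⟨c, hc, ?_⟩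
    apply eq_of_eleven <;> simp [nbrFromA, h0, h1, h2, h3, h4, h5, h6, h7, h8, h9, h10]
  · rintro ⟨c, hc, rfl⟩
    simp [nbrFromA]

lemma Drel_iff_nbrFromB (x : ℕ → ℕ) (a : Fin 11 → ZMod 3) :
    Drel 11 (ZMod 3) a (fun j : Fin 11 => (x j : ZMod 3)) ↔
      ∃ c ∈ [0, 1, 2], a = fun j : Fin 11 => (((nbrFromB x c).getD j 0 : ℕ) : ZMod 3) := by
  simp only [Drel_eleven_iff, add_add_eq_zero_iff_left]
  constructor
  · rintro ⟨h1, h2, h3, h4, h5, h6, h7, h8, h9, h10⟩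
    obtain ⟨c, hc, h0⟩ := exists_mem_cast_eq (a 0)
    refine ⟨c, hc, ?_⟩
    apply eq_of_eleven <;> simp [nbrFromB, h0, h1, h2, h3, h4, h5, h6, h7, h8, h9, h10]
  · rintro ⟨c, hc, rfl⟩
    simp [nbrFromB]

lemma sub_linear_eq_zero_iff_right (x x' y y' z : ZMod 3) :
    x - x' + y - y' + z = 0 ↔ y = 2 * (x + 2 * x' + 2 * y' + z) := by
  revert x x' y y' z
  decide

lemma sub_linear_eq_zero_iff_left (x x' y y' z : ZMod 3) :
    x - x' + y - y' + z = 0 ↔ x = 2 * (y + 2 * y' + 2 * x' + z) := by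
  revert x x' y y' z
  decide

lemma add_linear_eq_zero_iff_right (x x' y y' z : ZMod 3) :
    x + x' + y + y' + z = 0 ↔ y = 2 * (x + x' + y' + z) := by
  revert x x' y y' z
  decide

lemma add_linear_eq_zero_iff_left (x x' y y' z : ZMod 3) :
    x + x' + y + y' + z = 0 ↔ x = 2 * (y + y' + x' + z) := by
  revert x x' y y' z
  decide

lemma D'rel_iff_nbrFromA' (x : ℕ → ℕ) (b : Fin 11 → ZMod 3) :
    D'rel 11 (ZMod 3) (fun j : Fin 11 => (x j : ZMod 3)) b ↔
      ∃ c ∈ [0, 1, 2], b = fun j : Fin 11 => (((nbrFromA' x c).getD j 0 : ℕ) : ZMod 3) := by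
  simp only [D'rel_eleven_iff, sub_linear_eq_zero_iff_right, add_linear_eq_zero_iff_right]
  constructor
  · rintro ⟨h1, h2, h3, h4, h5, h6, h7, h8, h9, h10⟩
    obtain ⟨c, hc, h0⟩ := exists_mem_cast_eq (b 0)
    refine ⟨c, hc, ?_⟩
    apply eq_of_eleven <;> simp [nbrFromA', h0, h1, h2, h3, h4, h5, h6, h7, h8, h9, h10]
  · rintro ⟨c, hc, rfl⟩
    simp [nbrFromA']

lemma D'rel_iff_nbrFromB' (x : ℕ → ℕ) (a : Fin 11 → ZMod 3) :
    D'rel 11 (ZMod 3) a (fun j : Fin 11 => (x j : ZMod 3)) ↔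
      ∃ c ∈ [0, 1, 2], a = fun j : Fin 11 => (((nbrFromB' x c).getD j 0 : ℕ) : ZMod 3) := by
  simp only [D'rel_eleven_iff, sub_linear_eq_zero_iff_left, add_linear_eq_zero_iff_left]
  constructor
  · rintro ⟨h1, h2, h3, h4, h5, h6, h7, h8, h9, h10⟩
    obtain ⟨c, hc, h0⟩ := exists_mem_cast_eq (a 0)
    refine ⟨c, hc, ?_⟩
    apply eq_of_eleven <;> simp [nbrFromB', h0, h1, h2, h3, h4, h5, h6, h7, h8, h9, h10]
  · rintro ⟨c, hc, rfl⟩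
    simp [nbrFromB']

lemma adj_codeVertex_iff {r : (Fin 11 → ZMod 3) → (Fin 11 → ZMod 3) → Prop}
    {fromA fromB : (ℕ → ℕ) → ℕ → List ℕ}
    (hA : ∀ x b, r (fun j : Fin 11 => (x j : ZMod 3)) b ↔
      ∃ c ∈ [0, 1, 2], b = fun j : Fin 11 => (((fromA x c).getD j 0 : ℕ) : ZMod 3))
    (hB : ∀ x a, r a (fun j : Fin 11 => (x j : ZMod 3)) ↔
      ∃ c ∈ [0, 1, 2], a = fun j : Fin 11 => (((fromB x c).getD j 0 : ℕ) : ZMod 3))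
    (n x : ℕ) (w : (Fin 11 → ZMod 3) ⊕ (Fin 11 → ZMod 3)) :
    (SimpleGraph.fromRel
      (fun x y => ∃ a b, x = Sum.inl a ∧ y = Sum.inr b ∧ r a b)).Adj (codeVertex n x) w ↔
      ∃ y ∈ stepOf fromA fromB n x, w = codeVertex (n + 1) y := by
  have hA' := fun b => hA (fun j => x / 3 ^ j) b
  have hB' := fun a => hB (fun j => x / 3 ^ j) a
  simp only [stepOf, List.mem_map, codeVertex, Nat.bodd_succ]
  cases n.bodd
  · simp only [cond_false, Bool.not_false, cond_true]
    rw [adj_fromRel_inl]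
    constructor
    · rintro ⟨b, hb, rfl⟩
      obtain ⟨c, hc, rfl⟩ := (hA' b).1 hb
      exact ⟨_, ⟨c, hc, rfl⟩, congrArg Sum.inr (ofCode_toCode 11 _).symm⟩
    · rintro ⟨_, ⟨c, hc, rfl⟩, rfl⟩
      exact ⟨_, (hA' _).2 ⟨c, hc, ofCode_toCode 11 _⟩, rfl⟩
  · simp only [cond_true, Bool.not_true, cond_false]
    rw [adj_fromRel_inr]
    constructor
    · rintro ⟨a, ha, rfl⟩
      obtain ⟨c, hc, rfl⟩ := (hB' a).1 ha
      exact ⟨_, ⟨c, hc, rfl⟩, congrArg Sum.inl (ofCode_toCode 11 _).symm⟩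
    · rintro ⟨_, ⟨c, hc, rfl⟩, rfl⟩
      exact ⟨_, (hB' _).2 ⟨c, hc, ofCode_toCode 11 _⟩, rfl⟩

/-! ### Automorphisms of `D(11, q)` -/

section Automorphisms

variable {R : Type*} [CommRing R]

/-- The action on the part `A` of an automorphism of `D(11, q)` that adds `t` to the `i`-th
coordinate and fixes the earlier ones. -/
def shiftA (t : R) (a : Fin 11 → R) : Fin 11 → Fin 11 → R
  | 0 => ![a 0 + t, a 1, a 2 - t * a 1, a 3, a 4 - t * a 3, a 5, a 6 - t * a 5, a 7, a 8 - t * a 7,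
      a 9, a 10 - t * a 9]
  | 1 => ![a 0, a 1 + t, a 2 + t * a 0, a 3, a 4 + t * a 1, a 5 - t * a 1, a 6 + t * a 2,
      a 7 - t * a 3, a 8 + t * a 4, a 9 - t * a 5, a 10 + t * a 6]
  | 2 => ![a 0, a 1, a 2 + t, a 3, a 4, a 5, a 6 - t * a 1, a 7, a 8 - t * a 3, a 9, a 10 - t * a 5]
  | 3 => ![a 0, a 1, a 2, a 3 + t, a 4, a 5 + t * a 0, a 6, a 7 + t * a 1, a 8, a 9 + t * a 2, a 10]
  | 4 => ![a 0, a 1, a 2, a 3, a 4 + t, a 5, a 6 + t * a 0, a 7, a 8 + t * a 1, a 9, a 10 + t * a 2]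
  | 5 => ![a 0, a 1, a 2, a 3, a 4, a 5 + t, a 6, a 7, a 8, a 9 - t * a 1, a 10]
  | 6 => ![a 0, a 1, a 2, a 3, a 4, a 5, a 6 + t, a 7, a 8, a 9, a 10 - t * a 1]
  | 7 => ![a 0, a 1, a 2, a 3, a 4, a 5, a 6, a 7 + t, a 8, a 9 + t * a 0, a 10]
  | 8 => ![a 0, a 1, a 2, a 3, a 4, a 5, a 6, a 7, a 8 + t, a 9, a 10 + t * a 0]
  | 9 => ![a 0, a 1, a 2, a 3, a 4, a 5, a 6, a 7, a 8, a 9 + t, a 10]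
  | 10 => ![a 0, a 1, a 2, a 3, a 4, a 5, a 6, a 7, a 8, a 9, a 10 + t]

/-- The action on the part `B` of the automorphism of `D(11, q)` given on `A` by `shiftA`. -/
def shiftB (t : R) (b : Fin 11 → R) : Fin 11 → Fin 11 → R
  | 0 => ![b 0, b 1 - t * b 0, b 2 - 2 * t * b 1 + t ^ 2 * b 0, b 3, b 4 - t * b 3, b 5 - t * b 3,
      b 6 - t * b 4 - t * b 5 + t ^ 2 * b 3, b 7, b 8 - t * b 7, b 9 - t * b 7,
      b 10 - t * b 8 - t * b 9 + t ^ 2 * b 7]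
  | 1 => ![b 0, b 1 - t, b 2, b 3 - t * b 0, b 4 + t * b 1, b 5 - t * b 1, b 6 + t * b 2,
      b 7 - t * b 3, b 8 + t * b 4, b 9 - t * b 5, b 10 + t * b 6]
  | 2 => ![b 0, b 1, b 2 - t, b 3, b 4 - t * b 0, b 5, b 6 - t * b 1, b 7, b 8 - t * b 3, b 9,
      b 10 - t * b 5]
  | 3 => ![b 0, b 1, b 2, b 3 - t, b 4, b 5, b 6, b 7 + t * b 1, b 8, b 9 + t * b 2, b 10]
  | 4 => ![b 0, b 1, b 2, b 3, b 4 - t, b 5, b 6, b 7, b 8 + t * b 1, b 9, b 10 + t * b 2]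
  | 5 => ![b 0, b 1, b 2, b 3, b 4, b 5 - t, b 6, b 7 - t * b 0, b 8, b 9 - t * b 1, b 10]
  | 6 => ![b 0, b 1, b 2, b 3, b 4, b 5, b 6 - t, b 7, b 8 - t * b 0, b 9, b 10 - t * b 1]
  | 7 => ![b 0, b 1, b 2, b 3, b 4, b 5, b 6, b 7 - t, b 8, b 9, b 10]
  | 8 => ![b 0, b 1, b 2, b 3, b 4, b 5, b 6, b 7, b 8 - t, b 9, b 10]
  | 9 => ![b 0, b 1, b 2, b 3, b 4, b 5, b 6, b 7, b 8, b 9 - t, b 10]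
  | 10 => ![b 0, b 1, b 2, b 3, b 4, b 5, b 6, b 7, b 8, b 9, b 10 - t]

/-- The action on the part `A` of the automorphism of `D(11, q)` given on `B` by
`firstShiftB`. -/
def firstShiftA (t : R) (a : Fin 11 → R) : Fin 11 → R :=
  ![a 0, a 1 - t * a 0, a 2, a 3 - 2 * t * a 1 + t ^ 2 * a 0, a 4 - t * a 2, a 5 - t * a 2,
      a 6, a 7 - t * a 5 - t * a 4 + t ^ 2 * a 2, a 8 - t * a 6, a 9 - t * a 6, a 10]

/-- The action on the part `B` of an automorphism of `D(11, q)` that adds `t` to the first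
coordinate. -/
def firstShiftB (t : R) (b : Fin 11 → R) : Fin 11 → R :=
  ![b 0 + t, b 1, b 2, b 3 - t * b 1, b 4, b 5 - t * b 2, b 6, b 7 - t * b 4, b 8,
      b 9 - t * b 6, b 10]

lemma Drel_shift {a b : Fin 11 → R} (h : Drel 11 R a b) (t : R) (i : Fin 11) :
    Drel 11 R (shiftA t a i) (shiftB t b i) := by
  obtain ⟨h1, h2, h3, h4, h5, h6, h7, h8, h9, h10⟩ := (Drel_eleven_iff a b).1 h
  rw [Drel_eleven_iff]
  fin_cases i
  · simp only [shiftA, shiftB, Fin.isValue, Matrix.cons_val]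
    exact ⟨by linear_combination h1, by linear_combination h2 - t * h1, by linear_combination h3,
      by linear_combination h4 - t * h3, by linear_combination h5,
      by linear_combination h6 - t * h5, by linear_combination h7,
      by linear_combination h8 - t * h7, by linear_combination h9,
      by linear_combination h10 - t * h9⟩
  · simp only [shiftA, shiftB, Fin.isValue, Matrix.cons_val]
    exact ⟨by linear_combination h1, by linear_combination h2, by linear_combination h3,
      by linear_combination h4 + t * h1, by linear_combination h5 - t * h1,
      by linear_combination h6 + t * h2, by linear_combination h7 - t * h3,
      by linear_combination h8 + t * h4, by linear_combination h9 - t * h5,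
      by linear_combination h10 + t * h6⟩
  · simp only [shiftA, shiftB, Fin.isValue, Matrix.cons_val]
    exact ⟨by linear_combination h1, by linear_combination h2, by linear_combination h3,
      by linear_combination h4, by linear_combination h5, by linear_combination h6 - t * h1,
      by linear_combination h7, by linear_combination h8 - t * h3, by linear_combination h9,
      by linear_combination h10 - t * h5⟩
  · simp only [shiftA, shiftB, Fin.isValue, Matrix.cons_val]
    exact ⟨by linear_combination h1, by linear_combination h2, by linear_combination h3,
      by linear_combination h4, by linear_combination h5, by linear_combination h6,
      by linear_combination h7 + t * h1, by linear_combination h8,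
      by linear_combination h9 + t * h2, by linear_combination h10⟩
  · simp only [shiftA, shiftB, Fin.isValue, Matrix.cons_val]
    exact ⟨by linear_combination h1, by linear_combination h2, by linear_combination h3,
      by linear_combination h4, by linear_combination h5, by linear_combination h6,
      by linear_combination h7, by linear_combination h8 + t * h1, by linear_combination h9,
      by linear_combination h10 + t * h2⟩
  · simp only [shiftA, shiftB, Fin.isValue, Matrix.cons_val]
    exact ⟨by linear_combination h1, by linear_combination h2, by linear_combination h3,
      by linear_combination h4, by linear_combination h5, by linear_combination h6,
      by linear_combination h7, by linear_combination h8, by linear_combination h9 - t * h1,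
      by linear_combination h10⟩
  · simp only [shiftA, shiftB, Fin.isValue, Matrix.cons_val]
    exact ⟨by linear_combination h1, by linear_combination h2, by linear_combination h3,
      by linear_combination h4, by linear_combination h5, by linear_combination h6,
      by linear_combination h7, by linear_combination h8, by linear_combination h9,
      by linear_combination h10 - t * h1⟩
  · simp only [shiftA, shiftB, Fin.isValue, Matrix.cons_val]
    exact ⟨by linear_combination h1, by linear_combination h2, by linear_combination h3,
      by linear_combination h4, by linear_combination h5, by linear_combination h6,
      by linear_combination h7, by linear_combination h8, by linear_combination h9,
      by linear_combination h10⟩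
  · simp only [shiftA, shiftB, Fin.isValue, Matrix.cons_val]
    exact ⟨by linear_combination h1, by linear_combination h2, by linear_combination h3,
      by linear_combination h4, by linear_combination h5, by linear_combination h6,
      by linear_combination h7, by linear_combination h8, by linear_combination h9,
      by linear_combination h10⟩
  · simp only [shiftA, shiftB, Fin.isValue, Matrix.cons_val]
    exact ⟨by linear_combination h1, by linear_combination h2, by linear_combination h3,
      by linear_combination h4, by linear_combination h5, by linear_combination h6,
      by linear_combination h7, by linear_combination h8, by linear_combination h9,
      by linear_combination h10⟩
  · simp only [shiftA, shiftB, Fin.isValue, Matrix.cons_val]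
    exact ⟨by linear_combination h1, by linear_combination h2, by linear_combination h3,
      by linear_combination h4, by linear_combination h5, by linear_combination h6,
      by linear_combination h7, by linear_combination h8, by linear_combination h9,
      by linear_combination h10⟩

lemma Drel_firstShift {a b : Fin 11 → R} (h : Drel 11 R a b) (t : R) :
    Drel 11 R (firstShiftA t a) (firstShiftB t b) := by
  obtain ⟨h1, h2, h3, h4, h5, h6, h7, h8, h9, h10⟩ := (Drel_eleven_iff a b).1 h
  rw [Drel_eleven_iff]
  simp only [firstShiftA, firstShiftB, Fin.isValue, Matrix.cons_val]
  exact ⟨by linear_combination h1, by linear_combination h2, by linear_combination h3 - t * h1,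
      by linear_combination h4, by linear_combination h5 - t * h2, by linear_combination h6,
      by linear_combination h7 - t * h4, by linear_combination h8,
      by linear_combination h9 - t * h6, by linear_combination h10⟩

lemma shiftA_injective (t : R) (i : Fin 11) :
    Function.Injective (shiftA t · i) := by
  intro a a' h
  have h' : ∀ j, shiftA t a i j = shiftA t a' i j := congrFun h
  fin_cases i
  all_goals
    have e0 : a 0 = a' 0 := by simpa [shiftA] using h' 0
    have e1 : a 1 = a' 1 := by simpa [shiftA, e0] using h' 1
    have e2 : a 2 = a' 2 := by simpa [shiftA, e0, e1] using h' 2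
    have e3 : a 3 = a' 3 := by simpa [shiftA, e0, e1, e2] using h' 3
    have e4 : a 4 = a' 4 := by simpa [shiftA, e0, e1, e2, e3] using h' 4
    have e5 : a 5 = a' 5 := by simpa [shiftA, e0, e1, e2, e3, e4] using h' 5
    have e6 : a 6 = a' 6 := by simpa [shiftA, e0, e1, e2, e3, e4, e5] using h' 6
    have e7 : a 7 = a' 7 := by simpa [shiftA, e0, e1, e2, e3, e4, e5, e6] using h' 7
    have e8 : a 8 = a' 8 := by simpa [shiftA, e0, e1, e2, e3, e4, e5, e6, e7] using h' 8
    have e9 : a 9 = a' 9 := by simpa [shiftA, e0, e1, e2, e3, e4, e5, e6, e7, e8] using h' 9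
    have e10 : a 10 = a' 10 := by simpa [shiftA, e0, e1, e2, e3, e4, e5, e6, e7, e8, e9] using h' 10
    exact eq_of_eleven e0 e1 e2 e3 e4 e5 e6 e7 e8 e9 e10

lemma shiftB_injective (t : R) (i : Fin 11) :
    Function.Injective (shiftB t · i) := by
  intro b b' h
  have h' : ∀ j, shiftB t b i j = shiftB t b' i j := congrFun h
  fin_cases i
  all_goals
    have e0 : b 0 = b' 0 := by simpa [shiftB] using h' 0
    have e1 : b 1 = b' 1 := by simpa [shiftB, e0] using h' 1
    have e2 : b 2 = b' 2 := by simpa [shiftB, e0, e1] using h' 2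
    have e3 : b 3 = b' 3 := by simpa [shiftB, e0, e1, e2] using h' 3
    have e4 : b 4 = b' 4 := by simpa [shiftB, e0, e1, e2, e3] using h' 4
    have e5 : b 5 = b' 5 := by simpa [shiftB, e0, e1, e2, e3, e4] using h' 5
    have e6 : b 6 = b' 6 := by simpa [shiftB, e0, e1, e2, e3, e4, e5] using h' 6
    have e7 : b 7 = b' 7 := by simpa [shiftB, e0, e1, e2, e3, e4, e5, e6] using h' 7
    have e8 : b 8 = b' 8 := by simpa [shiftB, e0, e1, e2, e3, e4, e5, e6, e7] using h' 8
    have e9 : b 9 = b' 9 := by simpa [shiftB, e0, e1, e2, e3, e4, e5, e6, e7, e8] using h' 9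
    have e10 : b 10 = b' 10 := by simpa [shiftB, e0, e1, e2, e3, e4, e5, e6, e7, e8, e9] using h' 10
    exact eq_of_eleven e0 e1 e2 e3 e4 e5 e6 e7 e8 e9 e10

lemma firstShiftA_injective (t : R) :
    Function.Injective (firstShiftA t) := by
  intro a a' h
  have h' : ∀ j, firstShiftA t a j = firstShiftA t a' j := congrFun h
  have e0 : a 0 = a' 0 := by simpa [firstShiftA] using h' 0
  have e1 : a 1 = a' 1 := by simpa [firstShiftA, e0] using h' 1
  have e2 : a 2 = a' 2 := by simpa [firstShiftA, e0, e1] using h' 2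
  have e3 : a 3 = a' 3 := by simpa [firstShiftA, e0, e1, e2] using h' 3
  have e4 : a 4 = a' 4 := by simpa [firstShiftA, e0, e1, e2, e3] using h' 4
  have e5 : a 5 = a' 5 := by simpa [firstShiftA, e0, e1, e2, e3, e4] using h' 5
  have e6 : a 6 = a' 6 := by simpa [firstShiftA, e0, e1, e2, e3, e4, e5] using h' 6
  have e7 : a 7 = a' 7 := by simpa [firstShiftA, e0, e1, e2, e3, e4, e5, e6] using h' 7
  have e8 : a 8 = a' 8 := by simpa [firstShiftA, e0, e1, e2, e3, e4, e5, e6, e7] using h' 8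
  have e9 : a 9 = a' 9 := by simpa [firstShiftA, e0, e1, e2, e3, e4, e5, e6, e7, e8] using h' 9
  have e10 : a 10 = a' 10 := by
    simpa [firstShiftA, e0, e1, e2, e3, e4, e5, e6, e7, e8, e9] using h' 10
  exact eq_of_eleven e0 e1 e2 e3 e4 e5 e6 e7 e8 e9 e10

lemma firstShiftB_injective (t : R) :
    Function.Injective (firstShiftB t) := by
  intro b b' h
  have h' : ∀ j, firstShiftB t b j = firstShiftB t b' j := congrFun h
  have e0 : b 0 = b' 0 := by simpa [firstShiftB] using h' 0
  have e1 : b 1 = b' 1 := by simpa [firstShiftB, e0] using h' 1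
  have e2 : b 2 = b' 2 := by simpa [firstShiftB, e0, e1] using h' 2
  have e3 : b 3 = b' 3 := by simpa [firstShiftB, e0, e1, e2] using h' 3
  have e4 : b 4 = b' 4 := by simpa [firstShiftB, e0, e1, e2, e3] using h' 4
  have e5 : b 5 = b' 5 := by simpa [firstShiftB, e0, e1, e2, e3, e4] using h' 5
  have e6 : b 6 = b' 6 := by simpa [firstShiftB, e0, e1, e2, e3, e4, e5] using h' 6
  have e7 : b 7 = b' 7 := by simpa [firstShiftB, e0, e1, e2, e3, e4, e5, e6] using h' 7
  have e8 : b 8 = b' 8 := by simpa [firstShiftB, e0, e1, e2, e3, e4, e5, e6, e7] using h' 8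
  have e9 : b 9 = b' 9 := by simpa [firstShiftB, e0, e1, e2, e3, e4, e5, e6, e7, e8] using h' 9
  have e10 : b 10 = b' 10 := by
    simpa [firstShiftB, e0, e1, e2, e3, e4, e5, e6, e7, e8, e9] using h' 10
  exact eq_of_eleven e0 e1 e2 e3 e4 e5 e6 e7 e8 e9 e10

lemma shiftA_self (t : R) (a : Fin 11 → R) (i : Fin 11) : shiftA t a i i = a i + t := by
  fin_cases i <;> rfl

lemma shiftA_of_lt (t : R) (a : Fin 11 → R) {i j : Fin 11} (hij : j < i) :
    shiftA t a i j = a j := by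
  fin_cases i <;> fin_cases j <;> first | rfl | exact absurd hij (by decide)

lemma shiftB_self (t : R) (b : Fin 11 → R) {i : Fin 11} (hi : i ≠ 0) :
    shiftB t b i i = b i - t := by
  fin_cases i <;> first | rfl | exact absurd rfl hi

lemma shiftB_of_lt (t : R) (b : Fin 11 → R) {i j : Fin 11} (hij : j < i) :
    shiftB t b i j = b j := by
  fin_cases i <;> fin_cases j <;> first | rfl | exact absurd hij (by decide)

lemma ncard_walkEnds_DGraph_le [Finite R] {α β : (Fin 11 → R) → Fin 11 → R}
    (hα : Function.Injective α) (hβ : Function.Injective β)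
    (h : ∀ a b, Drel 11 R a b → Drel 11 R (α a) (β b)) (v : (Fin 11 → R) ⊕ (Fin 11 → R))
    (n : ℕ) : (walkEnds (DGraph 11 R) v n).ncard ≤
      (walkEnds (DGraph 11 R) (Sum.map α β v) n).ncard := by
  refine ncard_walkEnds_le (hα.sumMap hβ) ?_ v n
  rintro (a | b) w hw
  · obtain ⟨b, hab, rfl⟩ := (adj_fromRel_inl _ a w).1 hw
    exact (adj_fromRel_inl _ _ _).2 ⟨_, h a b hab, rfl⟩
  · obtain ⟨a, hab, rfl⟩ := (adj_fromRel_inr _ b w).1 hw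
    exact (adj_fromRel_inr _ _ _).2 ⟨_, h a b hab, rfl⟩

lemma ncard_walkEnds_le_shift [Finite R] (t : R) (i : Fin 11)
    (v : (Fin 11 → R) ⊕ (Fin 11 → R)) (n : ℕ) : (walkEnds (DGraph 11 R) v n).ncard ≤
      (walkEnds (DGraph 11 R) (Sum.map (shiftA t · i) (shiftB t · i) v) n).ncard :=
  ncard_walkEnds_DGraph_le (shiftA_injective t i) (shiftB_injective t i)
    (fun _ _ h => Drel_shift h t i) v n

lemma ncard_walkEnds_le_firstShift [Finite R] (t : R)
    (v : (Fin 11 → R) ⊕ (Fin 11 → R)) (n : ℕ) : (walkEnds (DGraph 11 R) v n).ncard ≤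
      (walkEnds (DGraph 11 R) (Sum.map (firstShiftA t) (firstShiftB t) v) n).ncard :=
  ncard_walkEnds_DGraph_le (firstShiftA_injective t) (firstShiftB_injective t)
    (fun _ _ h => Drel_firstShift h t) v n

/-- A property of vectors holds everywhere if it holds at `0` and the coordinates of a vector can
be cleared one after another without gaining the property. -/
lemma forall_of_clear_coordinates {k : ℕ} {P : (Fin k → R) → Prop} (h0 : P 0)
    (h : ∀ i v, ∃ w, (∀ j < i, w j = v j) ∧ w i = 0 ∧ (P w → P v)) (v : Fin k → R) : P v := by
  have key : ∀ m ≤ k, ∀ v : Fin k → R, (∀ j : Fin k, (j : ℕ) < k - m → v j = 0) → P v := by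
    intro m
    induction m with
    | zero =>
      intro _ v hv
      rwa [show v = 0 from funext fun j => hv j (by omega)]
    | succ m ih =>
      intro hm v hv
      obtain ⟨w, hw, hwi, hP⟩ := h ⟨k - (m + 1), by omega⟩ v
      refine hP (ih (by omega) w fun j hj => ?_)
      rcases Nat.lt_or_ge j (k - (m + 1)) with hlt | hge
      · rw [hw j hlt, hv j hlt]
      · rwa [show j = ⟨k - (m + 1), by omega⟩ from Fin.ext (by simp only; omega)]
  exact key k le_rfl v fun j hj => by omega

/-- The number of endpoints of walks of length `n` from a vertex of `D(11, q)` is at most that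
for the zero vector in one of the parts. -/
lemma ncard_walkEnds_DGraph_le_of_zero [Finite R] {n M : ℕ}
    (hA : (walkEnds (DGraph 11 R) (Sum.inl 0) n).ncard ≤ M)
    (hB : (walkEnds (DGraph 11 R) (Sum.inr 0) n).ncard ≤ M)
    (v : (Fin 11 → R) ⊕ (Fin 11 → R)) : (walkEnds (DGraph 11 R) v n).ncard ≤ M := by
  rcases v with a | b
  · refine forall_of_clear_coordinates
      (P := fun a => (walkEnds (DGraph 11 R) (Sum.inl a) n).ncard ≤ M) hA (fun i a => ?_) a
    exact ⟨shiftA (-a i) a i, fun j hj => shiftA_of_lt _ a hj,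
      by rw [shiftA_self, add_neg_cancel],
      (ncard_walkEnds_le_shift (-a i) i (Sum.inl a) n).trans⟩
  · refine forall_of_clear_coordinates
      (P := fun b => (walkEnds (DGraph 11 R) (Sum.inr b) n).ncard ≤ M) hB (fun i b => ?_) b
    by_cases hi : i = 0
    · subst hi
      exact ⟨firstShiftB (-b 0) b, fun j hj => absurd hj (Fin.not_lt_zero j),
        add_neg_cancel (b 0), (ncard_walkEnds_le_firstShift (-b 0) (Sum.inr b) n).trans⟩
    · exact ⟨shiftB (b i) b i, fun j hj => shiftB_of_lt _ b hj,
        by rw [shiftB_self _ _ hi, sub_self],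
        (ncard_walkEnds_le_shift (b i) i (Sum.inr b) n).trans⟩

end Automorphisms

/-! ### Counting endpoints of walks of length 10 -/

lemma ncard_walkEnds_DGraph_le_1993 (v : (Fin 11 → ZMod 3) ⊕ (Fin 11 → ZMod 3)) :
    (walkEnds (DGraph 11 (ZMod 3)) v 10).ncard ≤ 1993 := by
  have hstep := adj_codeVertex_iff Drel_iff_nbrFromA Drel_iff_nbrFromB
  apply ncard_walkEnds_DGraph_le_of_zero
  · rw [← codeVertex_zero_zero, ← length_of_hasLength hasLength_level_A]
    exact ncard_walkEnds_le_length hstep 10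
  · rw [← codeVertex_one_zero, ← length_of_hasLength hasLength_level_B]
    exact ncard_walkEnds_le_length (vert := fun n => codeVertex (n + 1))
      (fun n => hstep (n + 1)) 10

lemma le_ncard_walkEnds_D'Graph :
    2023 ≤ (walkEnds (D'Graph 11 (ZMod 3)) (Sum.inl 0) 10).ncard := by
  rw [← codeVertex_zero_zero]
  exact le_ncard_walkEnds (adj_codeVertex_iff D'rel_iff_nbrFromA' D'rel_iff_nbrFromB')
    codeVertex_ten_injOn increasingIn_level_A'

/-- The bipartite graphs `D'(11,3)` and `D(11,3)` are not isomorphic. -/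
theorem D'_11_3_not_iso_D_11_3 :
    ¬ Nonempty (D'Graph 11 (ZMod 3) ≃g DGraph 11 (ZMod 3)) := by
  rintro ⟨e⟩
  have h := ncard_walkEnds_le e.injective (fun _ _ => e.map_adj_iff.2) (Sum.inl 0) 10
  have h1 := le_ncard_walkEnds_D'Graph
  have h2 := ncard_walkEnds_DGraph_le_1993 (e (Sum.inl 0))
  omega

end Paper
end

section
/- Let q = 2^r and let 1 ≤ s ≤ r with gcd(s,r) = 1. Let G(2^r,s) be the bipartite graph with parts A = B = F_q^3 in which (a_1, a_2, a_3) ∈ A is adjacent to (b_1, b_2, b_3) ∈ B if and only if b_2 + a_2 = a_1 b_1 and b_3 + a_3 = a_1 b_1^{2^s}. Then G(2^r,s) contains no cycle of length 6; that is, there do not exist pairwise distinct vertices a, c, e ∈ A and pairwise distinct vertices b, d, f ∈ B such that ab, bc, cd, de, ef, fa are all edges. -/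
open scoped Classical

namespace Paper

/-- Adjacency in the bipartite graph `G(2^r, s)`: `(a₁,a₂,a₃) ∈ A` is adjacent to
`(b₁,b₂,b₃) ∈ B` iff `b₂ + a₂ = a₁b₁` and `b₃ + a₃ = a₁b₁^{2^s}`. -/
def GrsAdj {F : Type*} [Field F] (s : ℕ) (a b : F × F × F) : Prop :=
  b.2.1 + a.2.1 = a.1 * b.1 ∧ b.2.2 + a.2.2 = a.1 * b.1 ^ (2 ^ s)

theorem GrsAdj.left_eq {F : Type*} [Field F] {s : ℕ} {a c b : F × F × F}
    (hab : GrsAdj s a b) (hcb : GrsAdj s c b) (h : a.1 = c.1) : a = c := by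
  obtain ⟨h₂, h₃⟩ := hab
  obtain ⟨k₂, k₃⟩ := hcb
  rw [h] at h₂ h₃
  exact Prod.ext h (Prod.ext (add_left_cancel (h₂.trans k₂.symm))
    (add_left_cancel (h₃.trans k₃.symm)))

theorem GrsAdj.right_eq {F : Type*} [Field F] {s : ℕ} {a b d : F × F × F}
    (hab : GrsAdj s a b) (had : GrsAdj s a d) (h : b.1 = d.1) : b = d := by
  obtain ⟨h₂, h₃⟩ := hab
  obtain ⟨k₂, k₃⟩ := had
  rw [h] at h₂ h₃
  exact Prod.ext h (Prod.ext (add_right_cancel (h₂.trans k₂.symm))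
    (add_right_cancel (h₃.trans k₃.symm)))

/-- In a field with `p ^ r` elements, a nonzero fixed point of the `p ^ s`-power map is a root of
unity of order dividing `p ^ gcd s r - 1`. -/
theorem pow_pow_gcd_sub_one_eq_one {F : Type*} [Field F] [Fintype F] {p r s : ℕ} (hp : p ≠ 0)
    (hcard : Fintype.card F = p ^ r) {t : F} (ht : t ≠ 0) (h : t ^ p ^ s = t) :
    t ^ (p ^ Nat.gcd s r - 1) = 1 := by
  have hs : t ^ (p ^ s - 1) = 1 := by
    apply mul_right_cancel₀ ht
    rw [← pow_succ, Nat.sub_add_cancel (Nat.one_le_iff_ne_zero.2 (pow_ne_zero s hp)), h, one_mul]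
  have hr : t ^ (p ^ r - 1) = 1 := hcard ▸ FiniteField.pow_card_sub_one_eq_one t ht
  rw [← Nat.pow_sub_one_gcd_pow_sub_one]
  exact orderOf_dvd_iff_pow_eq_one.1
    (Nat.dvd_gcd (orderOf_dvd_of_pow_eq_one hs) (orderOf_dvd_of_pow_eq_one hr))

/-- For `q = 2^r` and `1 ≤ s ≤ r` with `gcd(s,r) = 1`, the graph `G(2^r,s)`
contains no cycle of length 6. -/
theorem Grs_C6_free (r s : ℕ) (hs : 1 ≤ s) (hsr : s ≤ r) (hgcd : Nat.gcd s r = 1)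
    (F : Type) [Field F] [Fintype F] (hcard : Fintype.card F = 2 ^ r) :
    ¬ ∃ a c e b d f : F × F × F,
        a ≠ c ∧ a ≠ e ∧ c ≠ e ∧ b ≠ d ∧ b ≠ f ∧ d ≠ f ∧
        GrsAdj s a b ∧ GrsAdj s c b ∧ GrsAdj s c d ∧
        GrsAdj s e d ∧ GrsAdj s e f ∧ GrsAdj s a f := by
  rintro ⟨a, c, e, b, d, f, hac, hae, hce, hbd, hbf, hdf, ab, cb, cd, ed, ef, af⟩
  have : Fact (Nat.Prime 2) := ⟨Nat.prime_two⟩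
  have : CharP F 2 := charP_of_card_eq_prime_pow hcard
  have hx : a.1 - c.1 ≠ 0 := sub_ne_zero.2 fun h => hac (ab.left_eq cb h)
  have hu : b.1 - f.1 ≠ 0 := sub_ne_zero.2 fun h => hbf (ab.right_eq af h)
  have hv : d.1 - f.1 ≠ 0 := sub_ne_zero.2 fun h => hdf (ed.right_eq ef h)
  have h₂ : (a.1 - c.1) * (b.1 - f.1) = -((c.1 - e.1) * (d.1 - f.1)) := by
    linear_combination cb.1 - ab.1 + ed.1 - cd.1 + af.1 - ef.1
  have h₃ : (a.1 - c.1) * (b.1 - f.1) ^ 2 ^ s = -((c.1 - e.1) * (d.1 - f.1) ^ 2 ^ s) := by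
    rw [sub_pow_char_pow, sub_pow_char_pow]
    linear_combination cb.2 - ab.2 + ed.2 - cd.2 + af.2 - ef.2
  have hfix : ((b.1 - f.1) / (d.1 - f.1)) ^ 2 ^ s = (b.1 - f.1) / (d.1 - f.1) := by
    rw [div_pow, div_eq_div_iff (pow_ne_zero _ hv) hv]
    apply mul_left_cancel₀ hx
    linear_combination (d.1 - f.1) * h₃ - (d.1 - f.1) ^ 2 ^ s * h₂
  have hone := pow_pow_gcd_sub_one_eq_one two_ne_zero hcard (div_ne_zero hu hv) hfix
  rw [hgcd, pow_one, Nat.add_one_sub_one, pow_one, div_eq_one_iff_eq hv, sub_left_inj] at hone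
  exact hbd (cb.right_eq cd hone)

end Paper
end

section
/- Let q = 2^r and let 1 ≤ s ≤ r with gcd(s,r) = 1. If x, y, z ∈ F_q are pairwise distinct, then the 3×3 matrix M(x,y,z) with rows (1, 1, 1), (x, y, z), (x^{2^s}, y^{2^s}, z^{2^s}) is invertible. -/
open scoped Classical

namespace Paper

/-- In a field with `2 ^ r` elements and `s` coprime to `r`, the nonzero fixed points of
`t ↦ t ^ 2 ^ s` are trivial. -/
theorem eq_one_of_pow_two_pow_eq_self {K : Type*} [Field K] [Fintype K] {r s : ℕ}
    (hgcd : Nat.gcd s r = 1) (hcard : Fintype.card K = 2 ^ r) {t : K} (ht : t ≠ 0)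
    (hfix : t ^ 2 ^ s = t) : t = 1 := by
  have hr : t ^ (2 ^ r - 1) = 1 := hcard ▸ FiniteField.pow_card_sub_one_eq_one t ht
  have hs : t ^ (2 ^ s - 1) = 1 := by
    apply mul_right_cancel₀ ht
    rw [pow_sub_one_mul (by positivity), hfix, one_mul]
  have h := Nat.dvd_gcd (orderOf_dvd_of_pow_eq_one hs) (orderOf_dvd_of_pow_eq_one hr)
  rw [Nat.pow_sub_one_gcd_pow_sub_one, hgcd] at h
  exact orderOf_eq_one_iff.mp (Nat.dvd_one.mp h)

/-- For `q = 2^r`, `1 ≤ s ≤ r` with `gcd(s,r) = 1`, and pairwise distinct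
`x, y, z ∈ F_q`, the matrix with rows `(1,1,1)`, `(x,y,z)`, `(x^{2^s}, y^{2^s}, z^{2^s})` is
invertible. -/
theorem vandermonde_like_invertible (r s : ℕ) (hs : 1 ≤ s) (hsr : s ≤ r)
    (hgcd : Nat.gcd s r = 1)
    (F : Type) [Field F] [Fintype F] (hcard : Fintype.card F = 2 ^ r)
    (x y z : F) (hxy : x ≠ y) (hxz : x ≠ z) (hyz : y ≠ z) :
    IsUnit (!![1, 1, 1; x, y, z; x ^ (2 ^ s), y ^ (2 ^ s), z ^ (2 ^ s)] : Matrix (Fin 3) (Fin 3) F) := by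
  have : CharP F 2 := charP_of_card_eq_prime_pow hcard
  rw [Matrix.isUnit_iff_isUnit_det, isUnit_iff_ne_zero]
  intro hdet
  have hu : y - x ≠ 0 := sub_ne_zero.mpr hxy.symm
  have hv : z - x ≠ 0 := sub_ne_zero.mpr hxz.symm
  have key : (z - x) ^ 2 ^ s * (y - x) = (z - x) * (y - x) ^ 2 ^ s := by
    rw [sub_pow_char_pow, sub_pow_char_pow]
    simp only [Matrix.det_fin_three, Matrix.of_apply, Matrix.cons_val] at hdet
    linear_combination hdet
  have hfix : ((z - x) / (y - x)) ^ 2 ^ s = (z - x) / (y - x) := by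
    rw [div_pow, div_eq_div_iff (pow_ne_zero _ hu) hu, key]
  have h1 := eq_one_of_pow_two_pow_eq_self hgcd hcard (div_ne_zero hv hu) hfix
  exact hyz (sub_left_injective ((div_eq_one_iff_eq hu).mp h1)).symm

end Paper
end
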